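/- arXiv:1609.07211 — 3 statements merged into one kernel-verified Lean document; each statement's English description precedes it below -/
import Mathlib

section
/- For every real number c there exists a constant C > 0 (depending only on c) such that for all real numbers A with A > 0 and |c| < A/2, and all real numbers t, one has |Γ(A + c + i t)| ≤ C · |A + i t|^c · |Γ(A + i t)|. -/
open Complex

/-- Near `w = 0`, `log ‖1 + w‖` agrees with `re w` up to a quadratic error. -/
lemma abs_log_norm_one_add_sub_re_le_of_norm_le {w : ℂ} (hw : ‖w‖ ≤ 1 / 2) :
    |Real.log ‖1 + w‖ - w.re| ≤ ‖w‖ ^ 2 := by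
  have h1 := norm_log_one_add_sub_self_le (z := w) (by linarith)
  have h2 : Real.log ‖1 + w‖ - w.re = (Complex.log (1 + w) - w).re := by
    simp [Complex.log_re]
  rw [h2]
  refine (abs_re_le_norm _).trans (h1.trans ?_)
  have h3 : (1 - ‖w‖)⁻¹ ≤ 2 := by
    rw [inv_le_comm₀ (by linarith) (by norm_num)]; linarith
  nlinarith [sq_nonneg ‖w‖]

/-- On the right half-plane `log ‖1 + w‖` agrees with `re w` up to a quadratic error. -/
lemma abs_log_norm_one_add_sub_re_le_of_re_nonneg {w : ℂ} (hw : 0 ≤ w.re) :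
    |Real.log ‖1 + w‖ - w.re| ≤ 2 * ‖w‖ ^ 2 := by
  rcases le_or_gt ‖w‖ (1 / 2) with h | h
  · exact (abs_log_norm_one_add_sub_re_le_of_norm_le h).trans (by nlinarith [sq_nonneg ‖w‖])
  · have h1 : 1 ≤ ‖1 + w‖ := by
      have := re_le_norm (1 + w)
      simp only [add_re, one_re] at this
      linarith
    have h2 : ‖1 + w‖ ≤ 1 + ‖w‖ := by simpa using norm_add_le 1 w
    have h3 := Real.log_nonneg h1
    have h4 := Real.log_le_sub_one_of_pos (zero_lt_one.trans_le h1)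
    have h5 := re_le_norm w
    rw [abs_le]
    constructor <;> nlinarith

lemma norm_div_norm_add_le {z : ℂ} {c : ℝ} (hz : 0 < z.re) (hc : 2 * |c| ≤ z.re) :
    ‖z‖ / ‖z + c‖ ≤ Real.exp ((c ^ 2 + 2 * |c|) / z.re ^ 2) * (‖z‖ / ‖z + 1‖) ^ c := by
  have hz0 : z ≠ 0 := by rintro rfl; simp at hz
  have hzc : z + c ≠ 0 := by
    intro h
    have := congrArg re h
    simp only [add_re, ofReal_re, zero_re] at this
    linarith [neg_abs_le c, abs_nonneg c]
  have hz1 : z + 1 ≠ 0 := by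
    intro h
    have := congrArg re h
    simp only [add_re, one_re, zero_re] at this
    linarith
  have pz := norm_pos_iff.mpr hz0
  have pzc := norm_pos_iff.mpr hzc
  have pz1 := norm_pos_iff.mpr hz1
  have hre : z.re ≤ ‖z‖ := re_le_norm z
  have hinv : ‖z⁻¹‖ ^ 2 ≤ 1 / z.re ^ 2 := by
    rw [norm_inv, inv_pow, ← one_div]
    gcongr
  have e1 : Real.log ‖1 + z⁻¹‖ = Real.log ‖z + 1‖ - Real.log ‖z‖ := by
    rw [← Real.log_div pz1.ne' pz.ne', ← norm_div, add_div, div_self hz0, one_div]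
  have e2 : Real.log ‖1 + c * z⁻¹‖ = Real.log ‖z + c‖ - Real.log ‖z‖ := by
    rw [← Real.log_div pzc.ne' pz.ne', ← norm_div, add_div, div_self hz0, div_eq_mul_inv]
  have hn : ‖(c : ℂ) * z⁻¹‖ = |c| * ‖z⁻¹‖ := by simp
  have b1 := abs_log_norm_one_add_sub_re_le_of_re_nonneg (w := z⁻¹) (by
    rw [inv_re]; exact div_nonneg hz.le (normSq_nonneg z))
  have b2 := abs_log_norm_one_add_sub_re_le_of_norm_le (w := c * z⁻¹) (by
    rw [hn, norm_inv, ← div_eq_mul_inv, div_le_iff₀ pz]; linarith)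
  rw [e1] at b1
  rw [e2, hn, mul_pow, sq_abs, re_ofReal_mul] at b2
  have b3 : c * (Real.log ‖z + 1‖ - Real.log ‖z‖ - z⁻¹.re) ≤ |c| * (2 * ‖z⁻¹‖ ^ 2) := by
    refine (le_abs_self _).trans ?_
    rw [abs_mul]
    gcongr
  have b4 : (c ^ 2 + 2 * |c|) * ‖z⁻¹‖ ^ 2 ≤ (c ^ 2 + 2 * |c|) / z.re ^ 2 := by
    rw [div_eq_mul_one_div]
    gcongr
  rw [Real.rpow_def_of_pos (by positivity), ← Real.exp_add, ← Real.log_le_iff_le_exp (by positivity),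
    Real.log_div pz.ne' pzc.ne', Real.log_div pz.ne' pz1.ne']
  linarith [(abs_le.mp b2).1]

lemma prod_norm_div_norm_add_le {z : ℂ} {c : ℝ} (hz : 0 < z.re) (hc : 2 * |c| ≤ z.re) (n : ℕ) :
    ∏ k ∈ Finset.range n, (‖z + k‖ / ‖z + c + k‖) ≤
      Real.exp (∑ k ∈ Finset.range n, (c ^ 2 + 2 * |c|) / (z.re + k) ^ 2) *
        (‖z‖ / ‖z + n‖) ^ c := by
  have pos (k : ℕ) : 0 < ‖z + k‖ := by
    refine lt_of_lt_of_le ?_ (re_le_norm _)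
    simp only [add_re, natCast_re]
    positivity
  induction n with
  | zero =>
    have := pos 0
    simp only [Nat.cast_zero, add_zero] at this
    simp [div_self this.ne']
  | succ n ih =>
    have p0 : 0 < ‖z‖ := by simpa using pos 0
    have pn := pos n
    have pn1 := pos (n + 1)
    have hstep := norm_div_norm_add_le (z := z + n) (c := c)
      (by simp only [add_re, natCast_re]; positivity)
      (by simp only [add_re, natCast_re]; linarith [n.cast_nonneg (α := ℝ)])
    rw [add_right_comm z (n : ℂ) c, add_assoc z (n : ℂ) 1] at hstep
    simp only [add_re, natCast_re] at hstep
    push_cast at pn1 ⊢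
    rw [Finset.prod_range_succ, Finset.sum_range_succ, Real.exp_add]
    refine (mul_le_mul ih hstep (by positivity) (by positivity)).trans_eq ?_
    rw [mul_mul_mul_comm, ← Real.mul_rpow (by positivity) (by positivity),
      div_mul_div_cancel₀ pn.ne']

lemma norm_GammaSeq_add_ofReal {z : ℂ} {c : ℝ} (hz : 0 < z.re) {n : ℕ} (hn : 0 < n) :
    ‖GammaSeq (z + c) n‖ =
      (n : ℝ) ^ c * (∏ k ∈ Finset.range (n + 1), (‖z + k‖ / ‖z + c + k‖)) * ‖GammaSeq z n‖ := by
  have pos : ∏ k ∈ Finset.range (n + 1), ‖z + k‖ ≠ 0 := by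
    refine Finset.prod_ne_zero_iff.mpr fun k _ ↦ ?_
    refine (lt_of_lt_of_le ?_ (re_le_norm _)).ne'
    simp only [add_re, natCast_re]
    positivity
  have hn' : (0 : ℝ) < n := by exact_mod_cast hn
  simp only [GammaSeq, norm_div, norm_mul, norm_prod, norm_natCast_cpow_of_pos hn,
    add_re, ofReal_re, Finset.prod_div_distrib, Real.rpow_add hn']
  field_simp

lemma tendsto_natCast_div_norm_add_succ (z : ℂ) :
    Filter.Tendsto (fun n : ℕ ↦ (n : ℝ) / ‖z + (n + 1 : ℕ)‖) Filter.atTop (nhds 1) := by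
  have h := (tendsto_natCast_div_add_atTop (𝕜 := ℂ) (z + 1)).norm
  rw [norm_one] at h
  refine h.congr fun n ↦ ?_
  rw [norm_div, norm_natCast]
  congr 2
  push_cast
  ring

lemma norm_Gamma_add_ofReal_le {z : ℂ} {c B : ℝ} (hz : 0 < z.re) (hc : 2 * |c| ≤ z.re)
    (hB : ∀ n : ℕ, ∑ k ∈ Finset.range n, (c ^ 2 + 2 * |c|) / (z.re + k) ^ 2 ≤ B) :
    ‖Gamma (z + c)‖ ≤ Real.exp B * ‖z‖ ^ c * ‖Gamma z‖ := by
  have hlim : Filter.Tendsto (fun n : ℕ ↦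
      Real.exp B * ‖z‖ ^ c * ((n : ℝ) / ‖z + (n + 1 : ℕ)‖) ^ c * ‖GammaSeq z n‖)
      Filter.atTop (nhds (Real.exp B * ‖z‖ ^ c * 1 ^ c * ‖Gamma z‖)) :=
    (((tendsto_natCast_div_norm_add_succ z).rpow_const (Or.inl one_ne_zero)).const_mul _).mul
      (GammaSeq_tendsto_Gamma z).norm
  rw [Real.one_rpow, mul_one] at hlim
  refine le_of_tendsto_of_tendsto (GammaSeq_tendsto_Gamma (z + c)).norm hlim ?_
  filter_upwards [Filter.eventually_gt_atTop 0] with n hn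
  rw [norm_GammaSeq_add_ofReal hz hn]
  have hprod := (prod_norm_div_norm_add_le hz hc (n + 1)).trans
    (mul_le_mul_of_nonneg_right (Real.exp_le_exp.mpr (hB (n + 1))) (by positivity))
  refine mul_le_mul_of_nonneg_right ?_ (norm_nonneg _)
  calc (n : ℝ) ^ c * ∏ k ∈ Finset.range (n + 1), (‖z + k‖ / ‖z + c + k‖)
      ≤ (n : ℝ) ^ c * (Real.exp B * (‖z‖ / ‖z + (n + 1 : ℕ)‖) ^ c) := by gcongr
    _ = Real.exp B * ‖z‖ ^ c * ((n : ℝ) / ‖z + (n + 1 : ℕ)‖) ^ c := by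
      rw [Real.div_rpow (norm_nonneg _) (norm_nonneg _),
        Real.div_rpow (Nat.cast_nonneg _) (norm_nonneg _)]
      ring

/-- Lemma 1 of Ganguly–Hoffstein–Sengupta (Lemma 4.1 in the paper):
for `A > 0` and a real constant `c` with `|c| < A/2`,
`Γ(A + c + it) ≪_c |A + it|^c · Γ(A + it)`. -/
theorem gamma_quotient_bound (c : ℝ) :
    ∃ C : ℝ, 0 < C ∧ ∀ A : ℝ, 0 < A → |c| < A / 2 → ∀ t : ℝ,
      ‖Complex.Gamma ((A : ℂ) + (c : ℂ) + (t : ℂ) * Complex.I)‖ ≤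
        C * (‖(A : ℂ) + (t : ℂ) * Complex.I‖) ^ c *
          ‖Complex.Gamma ((A : ℂ) + (t : ℂ) * Complex.I)‖ := by
  rcases eq_or_ne c 0 with rfl | hc0
  · exact ⟨1, one_pos, fun A _ _ t ↦ by simp⟩
  have hsum : Summable fun k : ℕ ↦ (c ^ 2 + 2 * |c|) * (1 / |k + 2 * abs c| ^ (2 : ℝ)) :=
    ((Real.summable_one_div_nat_add_rpow _ _).mpr one_lt_two).mul_left _
  refine ⟨_, Real.exp_pos (∑' k : ℕ, (c ^ 2 + 2 * |c|) * (1 / |k + 2 * abs c| ^ (2 : ℝ))),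
    fun A hA hcA t ↦ ?_⟩
  have hre : ((A : ℂ) + t * I).re = A := by simp
  rw [add_right_comm]
  refine norm_Gamma_add_ofReal_le (by rwa [hre]) (by rw [hre]; linarith) fun n ↦ ?_
  rw [hre]
  refine le_trans (Finset.sum_le_sum fun k _ ↦ ?_)
    (hsum.sum_le_tsum (Finset.range n) fun k _ ↦ by positivity)
  have hcpos := abs_pos.mpr hc0
  rw [div_eq_mul_one_div, Real.rpow_two, sq_abs]
  gcongr ?_ * (1 / ?_ ^ 2)
  linarith
end

section
/- Fix a positive integer n. There exists a constant C > 0 (depending only on n) such that for all tuples of even natural numbers k, l : Fin n → ℕ with l_j ≥ 2 and k_j ≥ 2·l_j for every j, and for every real number t, one has ∏_{j=1}^{n} |Γ((k_j − l_j + 1)/2 − 1/2 + i t)| · |Γ((k_j + l_j − 1)/2 − 1/2 + i t)| ≤ C · ∏_{j=1}^{n} Γ((k_j − l_j + 1)/2) · Γ((k_j + l_j − 1)/2) · k_j^{−1}. -/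
open Complex Finset

/-- In the right half-plane, `Γ` is bounded by its value at the real part. -/
lemma norm_Gamma_le_Gamma_re {s : ℂ} (hs : 0 < s.re) : ‖Complex.Gamma s‖ ≤ Real.Gamma s.re := by
  rw [Complex.Gamma_eq_integral hs, Complex.GammaIntegral, Real.Gamma_eq_integral hs]
  refine (MeasureTheory.norm_integral_le_integral_norm _).trans_eq ?_
  refine MeasureTheory.setIntegral_congr_fun measurableSet_Ioi fun x hx => ?_
  simp [Complex.norm_cpow_eq_rpow_re_of_pos (Set.mem_Ioi.mp hx), Complex.norm_exp]

/-- A Gautschi-type inequality, from the log-convexity of `Γ`. -/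
lemma sub_half_mul_sq_Gamma_le {a : ℝ} (ha : 1 / 2 < a) :
    (a - 1 / 2) * Real.Gamma a ^ 2 ≤ Real.Gamma (a + 1 / 2) ^ 2 := by
  have h1 : 0 < a - 1 / 2 := by linarith
  have h2 : 0 < a + 1 / 2 := by linarith
  have hG1 := (Real.Gamma_pos_of_pos h1).le
  have hG2 := (Real.Gamma_pos_of_pos h2).le
  have hconv := Real.Gamma_mul_add_mul_le_rpow_Gamma_mul_rpow_Gamma h1 h2
    (a := 1 / 2) (b := 1 / 2) (by norm_num) (by norm_num) (by norm_num)
  rw [show 1 / 2 * (a - 1 / 2) + 1 / 2 * (a + 1 / 2) = a by ring, ← Real.sqrt_eq_rpow,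
    ← Real.sqrt_eq_rpow] at hconv
  have hsq : Real.Gamma a ^ 2 ≤ Real.Gamma (a - 1 / 2) * Real.Gamma (a + 1 / 2) := by
    have := pow_le_pow_left₀ (Real.Gamma_pos_of_pos (by linarith : 0 < a)).le hconv 2
    rwa [mul_pow, Real.sq_sqrt hG1, Real.sq_sqrt hG2] at this
  have hrec := Real.Gamma_add_one h1.ne'
  rw [show a - 1 / 2 + 1 = a + 1 / 2 by ring] at hrec
  calc (a - 1 / 2) * Real.Gamma a ^ 2
      ≤ (a - 1 / 2) * (Real.Gamma (a - 1 / 2) * Real.Gamma (a + 1 / 2)) := by gcongr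
    _ = Real.Gamma (a + 1 / 2) ^ 2 := by rw [← mul_assoc, ← hrec, sq]

/-- If `x - 1 ≥ c > 0`, shifting the argument `x` by `-1/2 + it` gains a factor `c^{-1/2}`. -/
lemma mul_sq_norm_Gamma_sub_half_le {x c : ℝ} (hc : 0 < c) (hx : c ≤ x - 1) (t : ℝ) :
    c * ‖Complex.Gamma (((x - 1 / 2 : ℝ) : ℂ) + (t : ℂ) * Complex.I)‖ ^ 2 ≤
      Real.Gamma x ^ 2 := by
  have hre : (((x - 1 / 2 : ℝ) : ℂ) + (t : ℂ) * Complex.I).re = x - 1 / 2 := by simp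
  have hnorm := norm_Gamma_le_Gamma_re (s := ((x - 1 / 2 : ℝ) : ℂ) + (t : ℂ) * Complex.I)
    (by rw [hre]; linarith)
  rw [hre] at hnorm
  have h := sub_half_mul_sq_Gamma_le (a := x - 1 / 2) (by linarith)
  rw [sub_add_cancel] at h
  refine le_trans ?_ h
  gcongr <;> linarith

/-- The bound for a single pair of Gamma factors. -/
lemma norm_Gamma_mul_norm_Gamma_le {k l : ℝ} (hl : 2 ≤ l) (hkl : 2 * l ≤ k) (t : ℝ) :
    ‖Complex.Gamma ((((k - l + 1) / 2 - 1 / 2 : ℝ) : ℂ) + (t : ℂ) * Complex.I)‖ *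
        ‖Complex.Gamma ((((k + l - 1) / 2 - 1 / 2 : ℝ) : ℂ) + (t : ℂ) * Complex.I)‖ ≤
      8 * (Real.Gamma ((k - l + 1) / 2) * Real.Gamma ((k + l - 1) / 2) * k⁻¹) := by
  have hk : 0 < k := by linarith
  have h1 := mul_sq_norm_Gamma_sub_half_le (x := (k - l + 1) / 2) (c := k / 8)
    (by linarith) (by linarith) t
  have h2 := mul_sq_norm_Gamma_sub_half_le (x := (k + l - 1) / 2) (c := k / 8)
    (by linarith) (by linarith) t
  have hG1 := Real.Gamma_pos_of_pos (show 0 < (k - l + 1) / 2 by linarith)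
  have hG2 := Real.Gamma_pos_of_pos (show 0 < (k + l - 1) / 2 by linarith)
  set A := ‖Complex.Gamma ((((k - l + 1) / 2 - 1 / 2 : ℝ) : ℂ) + (t : ℂ) * Complex.I)‖
  set B := ‖Complex.Gamma ((((k + l - 1) / 2 - 1 / 2 : ℝ) : ℂ) + (t : ℂ) * Complex.I)‖
  have h : k / 8 * (A * B) ≤ Real.Gamma ((k - l + 1) / 2) * Real.Gamma ((k + l - 1) / 2) := by
    refine (sq_le_sq₀ (by positivity) (by positivity)).mp ?_
    calc (k / 8 * (A * B)) ^ 2 = (k / 8 * A ^ 2) * (k / 8 * B ^ 2) := by ring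
      _ ≤ Real.Gamma ((k - l + 1) / 2) ^ 2 * Real.Gamma ((k + l - 1) / 2) ^ 2 := by gcongr
      _ = _ := by ring
  calc A * B = 8 * (k / 8 * (A * B) * k⁻¹) := by field_simp
    _ ≤ _ := by gcongr

/-- The estimate `γ(1/2, −1/2 + it) ≪ k^{−1}` from Section 3 of the paper. -/
theorem gamma_factor_bound (n : ℕ) (hn : 0 < n) :
    ∃ C : ℝ, 0 < C ∧ ∀ k l : Fin n → ℕ,
      (∀ j, Even (k j)) → (∀ j, Even (l j)) →
      (∀ j, 2 ≤ l j) → (∀ j, 2 * l j ≤ k j) → ∀ t : ℝ,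
      (∏ j : Fin n,
          ‖Complex.Gamma
              ((((((k j : ℝ) - (l j : ℝ) + 1) / 2 - 1 / 2 : ℝ)) : ℂ) + (t : ℂ) * Complex.I)‖ *
            ‖Complex.Gamma
              ((((((k j : ℝ) + (l j : ℝ) - 1) / 2 - 1 / 2 : ℝ)) : ℂ) + (t : ℂ) * Complex.I)‖) ≤
        C * ∏ j : Fin n,
          Real.Gamma (((k j : ℝ) - (l j : ℝ) + 1) / 2) *
            Real.Gamma (((k j : ℝ) + (l j : ℝ) - 1) / 2) * (k j : ℝ)⁻¹ := by
  refine ⟨8 ^ n, by positivity, fun k l _ _ hl hkl t => ?_⟩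
  have hconst : (8 : ℝ) ^ n = ∏ _j : Fin n, (8 : ℝ) := by simp
  rw [hconst, ← Finset.prod_mul_distrib]
  refine Finset.prod_le_prod (fun j _ => by positivity) fun j _ => ?_
  exact norm_Gamma_mul_norm_Gamma_le (by exact_mod_cast hl j) (by exact_mod_cast hkl j) t
end

section
/- Let λ ≥ 0 and let l be a real number with l > 15 + 5λ. There exists a constant C > 0 (depending only on λ and l) such that for every real number k > 21 + 3λ and every real number v, the integral over t ∈ ℝ of |Γ((k − 7 − λ)/2 − i t/2)| · |Γ((3 + λ + l)/2 + i(t/2 − v))| / ( |Γ((k + 7 + λ)/2 + i t/2)| · |Γ((l − 3 − λ)/2 + i(v − t/2))| ) dt is at most C · k^{−6−λ} · (v² + k²)^{(3+λ)/2}. -/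
open Complex MeasureTheory

namespace Complex

/-- The failure of log-concavity of `|z|` along a unit horizontal segment is controlled by
`1 / (Re z)²`. -/
theorem norm_rpow_mul_norm_add_one_rpow_le {z : ℂ} {r θ : ℝ} (hr : 0 < r) (hz : r ≤ z.re)
    (h0 : 0 ≤ θ) (h1 : θ ≤ 1) :
    ‖z‖ ^ (1 - θ) * ‖z + 1‖ ^ θ ≤ (1 + 1 / (8 * r ^ 2)) * ‖z + θ‖ := by
  have hsq : ∀ w : ℂ, ‖w‖ ^ 2 = w.re ^ 2 + w.im ^ 2 := fun w ↦ by
    rw [Complex.sq_norm, Complex.normSq_apply]; ring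
  have hamgm : (‖z‖ ^ (1 - θ) * ‖z + 1‖ ^ θ) ^ 2 ≤ ‖z + θ‖ ^ 2 + 1 / 4 := by
    have h := Real.geom_mean_le_arith_mean2_weighted (sub_nonneg.2 h1) h0
      (sq_nonneg ‖z‖) (sq_nonneg ‖z + 1‖) (by ring)
    have e1 : (‖z‖ ^ 2) ^ (1 - θ) = (‖z‖ ^ (1 - θ)) ^ 2 := by
      rw [← Real.rpow_natCast, ← Real.rpow_natCast, ← Real.rpow_mul (norm_nonneg _),
        ← Real.rpow_mul (norm_nonneg _), mul_comm]
    have e2 : (‖z + 1‖ ^ 2) ^ θ = (‖z + 1‖ ^ θ) ^ 2 := by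
      rw [← Real.rpow_natCast, ← Real.rpow_natCast, ← Real.rpow_mul (norm_nonneg _),
        ← Real.rpow_mul (norm_nonneg _), mul_comm]
    rw [e1, e2, ← mul_pow, hsq, hsq] at h
    rw [hsq]
    simp only [add_re, add_im, one_re, one_im, ofReal_re, ofReal_im] at h ⊢
    nlinarith [sq_nonneg (θ - 1 / 2)]
  have hle : r ≤ ‖z + θ‖ := by
    refine le_trans ?_ (re_le_norm _)
    simp only [add_re, ofReal_re]
    linarith
  refine (sq_le_sq₀ (by positivity) (by positivity)).1 ?_
  refine hamgm.trans ?_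
  have hq : 1 / 4 ≤ 1 / (4 * r ^ 2) * ‖z + θ‖ ^ 2 := by
    have : r ^ 2 ≤ ‖z + θ‖ ^ 2 := by gcongr
    calc (1 / 4 : ℝ) = 1 / (4 * r ^ 2) * r ^ 2 := by field_simp
      _ ≤ _ := by gcongr
  have : ((1 + 1 / (8 * r ^ 2)) * ‖z + θ‖) ^ 2 =
      ‖z + θ‖ ^ 2 + 1 / (4 * r ^ 2) * ‖z + θ‖ ^ 2 + (1 / (8 * r ^ 2) * ‖z + θ‖) ^ 2 := by
    field_simp; ring
  rw [this]
  have := sq_nonneg (1 / (8 * r ^ 2) * ‖z + θ‖)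
  linarith

theorem prod_norm_add_mul_rpow_le {s : ℂ} {θ : ℝ} (hs : 1 ≤ s.re) (h0 : 0 ≤ θ) (h1 : θ ≤ 1)
    (m : ℕ) :
    (∏ j ∈ Finset.range m, ‖s + j‖) * ‖s + m‖ ^ θ ≤
      (2 - 1 / (m + 1)) * ‖s‖ ^ θ * ∏ j ∈ Finset.range m, ‖s + θ + j‖ := by
  induction m with
  | zero => norm_num
  | succ m ih =>
    rw [Finset.prod_range_succ, Finset.prod_range_succ]
    set P := ∏ j ∈ Finset.range m, ‖s + j‖
    set Q := ∏ j ∈ Finset.range m, ‖s + θ + j‖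
    have hP : 0 ≤ P := Finset.prod_nonneg fun _ _ ↦ norm_nonneg _
    have hQ : 0 ≤ Q := Finset.prod_nonneg fun _ _ ↦ norm_nonneg _
    have hm : (0 : ℝ) < m + 1 := by positivity
    have hre : (m : ℝ) + 1 ≤ (s + m).re := by simp; linarith
    have hpos : 0 < ‖s + m‖ := by
      have := re_le_norm (s + m)
      linarith
    have key := norm_rpow_mul_norm_add_one_rpow_le hm hre h0 h1
    have hsplit : ‖s + m‖ = ‖s + m‖ ^ θ * ‖s + m‖ ^ (1 - θ) := by
      rw [← Real.rpow_add hpos]; simp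
    have hcoef : (2 - 1 / ((m : ℝ) + 1)) * (1 + 1 / (8 * ((m : ℝ) + 1) ^ 2)) ≤
        2 - 1 / ((m : ℝ) + 1 + 1) := by
      rw [← sub_nonneg]
      have : 2 - 1 / ((m : ℝ) + 1 + 1) -
          (2 - 1 / ((m : ℝ) + 1)) * (1 + 1 / (8 * ((m : ℝ) + 1) ^ 2)) =
          (8 * (m + 1) ^ 2 - (2 * (m + 1) - 1) * (m + 2)) / (8 * (m + 1) ^ 3 * (m + 2)) := by
        field_simp; ring
      rw [this]
      apply div_nonneg _ (by positivity)
      have : (0 : ℝ) ≤ m := by positivity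
      nlinarith
    have e1 : s + ((m + 1 : ℕ) : ℂ) = s + m + 1 := by push_cast; ring
    have e2 : s + (θ : ℂ) + m = s + m + θ := by ring
    rw [e1, e2]
    have hA : 0 ≤ 2 - 1 / ((m : ℝ) + 1) := by
      have : 1 / ((m : ℝ) + 1) ≤ 1 := by
        rw [div_le_one hm]; linarith [(Nat.cast_nonneg m : (0 : ℝ) ≤ m)]
      linarith
    calc P * ‖s + m‖ * ‖s + m + 1‖ ^ θ
        = P * ‖s + m‖ ^ θ * (‖s + m‖ ^ (1 - θ) * ‖s + m + 1‖ ^ θ) := by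
          nth_rewrite 1 [hsplit]; ring
      _ ≤ ((2 - 1 / (m + 1)) * ‖s‖ ^ θ * Q) *
          ((1 + 1 / (8 * ((m : ℝ) + 1) ^ 2)) * ‖s + m + θ‖) := by gcongr
      _ = ((2 - 1 / ((m : ℝ) + 1)) * (1 + 1 / (8 * ((m : ℝ) + 1) ^ 2))) *
          (‖s‖ ^ θ * (Q * ‖s + m + θ‖)) := by ring
      _ ≤ (2 - 1 / ((m : ℝ) + 1 + 1)) * (‖s‖ ^ θ * (Q * ‖s + m + θ‖)) := by gcongr
      _ = _ := by push_cast; ring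

theorem norm_Gamma_add_le_of_le_one {s : ℂ} {θ : ℝ} (hs : 1 ≤ s.re) (h0 : 0 ≤ θ) (h1 : θ ≤ 1) :
    ‖Gamma (s + θ)‖ ≤ 2 * ‖s‖ ^ θ * ‖Gamma s‖ := by
  refine le_of_tendsto_of_tendsto (GammaSeq_tendsto_Gamma (s + θ)).norm
    ((GammaSeq_tendsto_Gamma s).norm.const_mul (2 * ‖s‖ ^ θ)) ?_
  filter_upwards [Filter.eventually_gt_atTop 0] with n hn
  have hn' : (0 : ℝ) < n := by exact_mod_cast hn
  have hne : ∀ w : ℂ, 1 ≤ w.re → ∀ j : ℕ, 0 < ‖w + j‖ := fun w hw j ↦ by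
    refine lt_of_lt_of_le ?_ (re_le_norm _)
    simp only [add_re, natCast_re]
    positivity
  simp only [GammaSeq, norm_div, norm_mul, norm_prod, norm_natCast_cpow_of_pos hn, add_re,
    ofReal_re]
  have hP : 0 < ∏ j ∈ Finset.range (n + 1), ‖s + j‖ :=
    Finset.prod_pos fun j _ ↦ hne s hs j
  have hQ : 0 < ∏ j ∈ Finset.range (n + 1), ‖s + θ + j‖ :=
    Finset.prod_pos fun j _ ↦ hne _ (by simp; linarith) j
  have key := prod_norm_add_mul_rpow_le hs h0 h1 (n + 1)
  set P := ∏ j ∈ Finset.range (n + 1), ‖s + j‖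
  set Q := ∏ j ∈ Finset.range (n + 1), ‖s + θ + j‖
  have hnle : (n : ℝ) ≤ ‖s + (n + 1 : ℕ)‖ := by
    refine le_trans ?_ (re_le_norm _)
    simp only [add_re, natCast_re]
    push_cast
    linarith
  have hkey : P * (n : ℝ) ^ θ ≤ 2 * ‖s‖ ^ θ * Q := by
    calc P * (n : ℝ) ^ θ ≤ P * ‖s + (n + 1 : ℕ)‖ ^ θ := by gcongr
      _ ≤ _ := key
      _ ≤ _ := by
        gcongr
        linarith [show (0 : ℝ) ≤ 1 / ((n + 1 : ℕ) + 1) by positivity]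
  rw [Real.rpow_add hn', ← mul_div_assoc, div_le_div_iff₀ hQ hP]
  calc _ = ((n : ℝ) ^ s.re * ‖(n.factorial : ℂ)‖) * (P * (n : ℝ) ^ θ) := by ring
    _ ≤ ((n : ℝ) ^ s.re * ‖(n.factorial : ℂ)‖) * (2 * ‖s‖ ^ θ * Q) := by gcongr
    _ = _ := by ring

theorem norm_le_norm_add_ofReal {s : ℂ} {δ : ℝ} (hs : 0 ≤ s.re) (hδ : 0 ≤ δ) :
    ‖s‖ ≤ ‖s + δ‖ := by
  refine (sq_le_sq₀ (norm_nonneg _) (norm_nonneg _)).1 ?_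
  rw [Complex.sq_norm, Complex.sq_norm, normSq_apply, normSq_apply]
  simp only [add_re, add_im, ofReal_re, ofReal_im]
  nlinarith [mul_nonneg hs hδ]

theorem norm_add_ofReal_le {s : ℂ} {δ : ℝ} (hs : 1 ≤ s.re) (hδ : 0 ≤ δ) :
    ‖s + δ‖ ≤ (1 + δ) * ‖s‖ := by
  have h1 : 1 ≤ ‖s‖ := hs.trans (re_le_norm s)
  calc ‖s + δ‖ ≤ ‖s‖ + ‖(δ : ℂ)‖ := norm_add_le _ _
    _ = ‖s‖ + δ * 1 := by rw [norm_real, Real.norm_of_nonneg hδ, mul_one]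
    _ ≤ ‖s‖ + δ * ‖s‖ := by gcongr
    _ = _ := by ring

/-- A property of nonnegative reals that holds on `[0, 1]` and passes from `δ` to `δ + 1` holds
everywhere. -/
theorem _root_.Real.induction_unit_step {p : ℝ → Prop} (base : ∀ θ, 0 ≤ θ → θ ≤ 1 → p θ)
    (step : ∀ δ, 0 ≤ δ → p δ → p (δ + 1)) {δ : ℝ} (hδ : 0 ≤ δ) : p δ := by
  have h : ∀ n : ℕ, p (Int.fract δ + n) := fun n ↦ by
    induction n with
    | zero => simpa using base _ (Int.fract_nonneg δ) (Int.fract_lt_one δ).le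
    | succ n ih =>
      have := step _ (add_nonneg (Int.fract_nonneg δ) n.cast_nonneg) ih
      rwa [add_assoc, ← Nat.cast_add_one] at this
  have hf := h ⌊δ⌋₊
  rwa [natCast_floor_eq_intCast_floor hδ, Int.fract_add_floor] at hf

theorem norm_Gamma_add_ofReal_add_one {s : ℂ} {δ : ℝ} (hs : 1 ≤ s.re) (hδ : 0 ≤ δ) :
    ‖Gamma (s + (δ + 1 : ℝ))‖ = ‖s + δ‖ * ‖Gamma (s + δ)‖ := by
  have hne : s + δ ≠ 0 := fun h ↦ by
    have := congrArg re h
    simp only [add_re, ofReal_re, zero_re] at this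
    linarith
  rw [← norm_mul, ← Gamma_add_one _ hne]
  push_cast
  rw [add_assoc]

theorem exists_norm_Gamma_add_le {δ : ℝ} (hδ : 0 ≤ δ) :
    ∃ C : ℝ, 0 < C ∧ ∀ s : ℂ, 1 ≤ s.re → ‖Gamma (s + δ)‖ ≤ C * ‖s‖ ^ δ * ‖Gamma s‖ := by
  refine Real.induction_unit_step (p := fun δ ↦ ∃ C : ℝ, 0 < C ∧ ∀ s : ℂ, 1 ≤ s.re →
    ‖Gamma (s + δ)‖ ≤ C * ‖s‖ ^ δ * ‖Gamma s‖) ?_ ?_ hδ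
  · exact fun θ h0 h1 ↦ ⟨2, two_pos, fun s hs ↦ norm_Gamma_add_le_of_le_one hs h0 h1⟩
  · rintro δ hδ ⟨C, hC, h⟩
    refine ⟨(1 + δ) * C, by positivity, fun s hs ↦ ?_⟩
    have hpos : 0 < ‖s‖ := by linarith [re_le_norm s]
    calc ‖Gamma (s + (δ + 1 : ℝ))‖ = ‖s + δ‖ * ‖Gamma (s + δ)‖ :=
          norm_Gamma_add_ofReal_add_one hs hδ
      _ ≤ ((1 + δ) * ‖s‖) * (C * ‖s‖ ^ δ * ‖Gamma s‖) :=
          mul_le_mul (norm_add_ofReal_le hs hδ) (h s hs) (norm_nonneg _) (by positivity)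
      _ = _ := by rw [Real.rpow_add_one hpos.ne']; ring

theorem exists_rpow_mul_norm_Gamma_le {δ : ℝ} (hδ : 0 ≤ δ) :
    ∃ C : ℝ, 0 < C ∧ ∀ s : ℂ, 1 ≤ s.re → ‖s‖ ^ δ * ‖Gamma s‖ ≤ C * ‖Gamma (s + δ)‖ := by
  refine Real.induction_unit_step (p := fun δ ↦ ∃ C : ℝ, 0 < C ∧ ∀ s : ℂ, 1 ≤ s.re →
    ‖s‖ ^ δ * ‖Gamma s‖ ≤ C * ‖Gamma (s + δ)‖) ?_ ?_ hδ
  · refine fun θ h0 h1 ↦ ⟨4, by norm_num, fun s hs ↦ ?_⟩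
    have hpos : 0 < ‖s‖ := by linarith [re_le_norm s]
    have hθ : 1 ≤ (s + θ).re := by simp only [add_re, ofReal_re]; linarith
    have h := norm_Gamma_add_le_of_le_one hθ (sub_nonneg.2 h1) (by linarith)
    have e : s + (θ : ℂ) + (1 - θ : ℝ) = s + 1 := by push_cast; ring
    rw [e, Gamma_add_one _ (norm_pos_iff.1 hpos), norm_mul] at h
    have hle : ‖s + θ‖ ^ (1 - θ) ≤ 2 * ‖s‖ ^ (1 - θ) := by
      have h2 : ‖s + θ‖ ≤ 2 * ‖s‖ := (norm_add_ofReal_le hs h0).trans (by gcongr; linarith)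
      calc ‖s + θ‖ ^ (1 - θ) ≤ (2 * ‖s‖) ^ (1 - θ) := by
            gcongr
        _ = 2 ^ (1 - θ) * ‖s‖ ^ (1 - θ) := Real.mul_rpow two_pos.le hpos.le
        _ ≤ 2 ^ (1 : ℝ) * ‖s‖ ^ (1 - θ) := by
            gcongr
            · norm_num
            · linarith
        _ = _ := by rw [Real.rpow_one]
    refine le_of_mul_le_mul_left ?_ (Real.rpow_pos_of_pos hpos (1 - θ))
    calc ‖s‖ ^ (1 - θ) * (‖s‖ ^ θ * ‖Gamma s‖) = ‖s‖ * ‖Gamma s‖ := by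
          rw [← mul_assoc, ← Real.rpow_add hpos]; simp
      _ ≤ 2 * ‖s + θ‖ ^ (1 - θ) * ‖Gamma (s + θ)‖ := h
      _ ≤ 2 * (2 * ‖s‖ ^ (1 - θ)) * ‖Gamma (s + θ)‖ := by gcongr
      _ = _ := by ring
  · rintro δ hδ ⟨C, hC, h⟩
    refine ⟨C, hC, fun s hs ↦ ?_⟩
    have hpos : 0 < ‖s‖ := by linarith [re_le_norm s]
    calc ‖s‖ ^ (δ + 1) * ‖Gamma s‖ = ‖s‖ * (‖s‖ ^ δ * ‖Gamma s‖) := by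
          rw [Real.rpow_add_one hpos.ne']; ring
      _ ≤ ‖s + δ‖ * (C * ‖Gamma (s + δ)‖) :=
          mul_le_mul (norm_le_norm_add_ofReal (by linarith) hδ) (h s hs) (by positivity)
            (norm_nonneg _)
      _ = C * ‖Gamma (s + (δ + 1 : ℝ))‖ := by rw [norm_Gamma_add_ofReal_add_one hs hδ]; ring

theorem norm_Gamma_sub_mul_I (x y : ℝ) :
    ‖Gamma (x - y * I)‖ = ‖Gamma (x + y * I)‖ := by
  rw [← norm_conj (Gamma (x + y * I)), ← Gamma_conj]
  simp [sub_eq_add_neg]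

end Complex

/-- A weight comparison of Peetre type, with the powers arising from the Gamma quotients. -/
theorem rpow_quotient_le {a k v t y N₁ N₂ : ℝ} (ha : 0 ≤ a) (hk : 1 ≤ k)
    (hN₁ : (k ^ 2 + t ^ 2) / 9 ≤ N₁ ^ 2) (hpos_N₁ : 0 < N₁) (hnonneg_N₂ : 0 ≤ N₂)
    (hN₂ : N₂ ^ 2 = y ^ 2 + (t / 2 - v) ^ 2) :
    (N₁ ^ (a + 4))⁻¹ * N₂ ^ a ≤
      9 ^ ((a + 4) / 2) * (y ^ 2 + 2) ^ (a / 2) * k ^ (-a - 4) * (v ^ 2 + k ^ 2) ^ (a / 2) *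
        (1 + (t / k) ^ 2)⁻¹ := by
  have hk0 : 0 < k := by linarith
  have half : ∀ N b : ℝ, 0 ≤ N → N ^ b = (N ^ 2) ^ (b / 2) := fun N b hN ↦ by
    rw [← Real.rpow_natCast, ← Real.rpow_mul hN]
    congr 1
    push_cast
    ring
  set w := k ^ 2 + t ^ 2 with hw
  have hw0 : 0 < w := by positivity
  have hN₂' : N₂ ^ 2 ≤ (y ^ 2 + 2) * (v ^ 2 + k ^ 2) * w / k ^ 2 := by
    have h1 : v ^ 2 + k ^ 2 + t ^ 2 ≤ (v ^ 2 + k ^ 2) * w / k ^ 2 := by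
      rw [le_div_iff₀ (by positivity), hw]
      nlinarith [mul_nonneg (sq_nonneg v) (sq_nonneg t)]
    have h2 : 1 ≤ k ^ 2 := one_le_pow₀ hk
    calc N₂ ^ 2 = y ^ 2 * 1 + (t / 2 - v) ^ 2 := by rw [hN₂, mul_one]
      _ ≤ y ^ 2 * (v ^ 2 + k ^ 2 + t ^ 2) + 2 * (v ^ 2 + k ^ 2 + t ^ 2) := by
        gcongr
        · nlinarith [sq_nonneg v, sq_nonneg t]
        · nlinarith [sq_nonneg (t / 2 + v), sq_nonneg t, sq_nonneg k]
      _ = (y ^ 2 + 2) * (v ^ 2 + k ^ 2 + t ^ 2) := by ring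
      _ ≤ (y ^ 2 + 2) * ((v ^ 2 + k ^ 2) * w / k ^ 2) := by gcongr
      _ = _ := by ring
  have hA : (N₁ ^ (a + 4))⁻¹ ≤ 9 ^ ((a + 4) / 2) * (w ^ (a / 2))⁻¹ * (w ^ 2)⁻¹ := by
    have h : (w / 9) ^ ((a + 4) / 2) ≤ N₁ ^ (a + 4) := by
      rw [half N₁ _ hpos_N₁.le]
      gcongr
    have e : ((w / 9) ^ ((a + 4) / 2))⁻¹ = 9 ^ ((a + 4) / 2) * (w ^ (a / 2))⁻¹ * (w ^ 2)⁻¹ := by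
      rw [Real.div_rpow hw0.le (by norm_num), inv_div, add_div, Real.rpow_add hw0,
        show (4 / 2 : ℝ) = (2 : ℕ) by norm_num, Real.rpow_natCast, div_eq_mul_inv, mul_inv,
        mul_assoc]
    rw [← e]
    gcongr
  have hB : N₂ ^ a ≤
      (y ^ 2 + 2) ^ (a / 2) * (v ^ 2 + k ^ 2) ^ (a / 2) * w ^ (a / 2) * k ^ (-a) := by
    calc N₂ ^ a = (N₂ ^ 2) ^ (a / 2) := half _ _ hnonneg_N₂
      _ ≤ ((y ^ 2 + 2) * (v ^ 2 + k ^ 2) * w / k ^ 2) ^ (a / 2) := by gcongr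
      _ = _ := by
        rw [Real.div_rpow (by positivity) (by positivity), Real.mul_rpow (by positivity) hw0.le,
          Real.mul_rpow (by positivity) (by positivity), ← half k a hk0.le,
          Real.rpow_neg hk0.le, div_eq_mul_inv]
  have hC : (w ^ 2)⁻¹ ≤ k ^ (-4 : ℝ) * (1 + (t / k) ^ 2)⁻¹ := by
    have e : k ^ (-4 : ℝ) * (1 + (t / k) ^ 2)⁻¹ = (k ^ 2 * w)⁻¹ := by
      rw [Real.rpow_neg hk0.le, show (4 : ℝ) = (4 : ℕ) by norm_num, Real.rpow_natCast, hw]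
      field_simp
    rw [e, pow_two w]
    gcongr
    rw [hw]
    linarith [sq_nonneg t]
  have hwa : 0 < w ^ (a / 2) := by positivity
  calc (N₁ ^ (a + 4))⁻¹ * N₂ ^ a
      ≤ (9 ^ ((a + 4) / 2) * (w ^ (a / 2))⁻¹ * (w ^ 2)⁻¹) *
        ((y ^ 2 + 2) ^ (a / 2) * (v ^ 2 + k ^ 2) ^ (a / 2) * w ^ (a / 2) * k ^ (-a)) := by gcongr
    _ = 9 ^ ((a + 4) / 2) * (y ^ 2 + 2) ^ (a / 2) * k ^ (-a) * (v ^ 2 + k ^ 2) ^ (a / 2) *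
        (w ^ 2)⁻¹ := by field_simp
    _ ≤ 9 ^ ((a + 4) / 2) * (y ^ 2 + 2) ^ (a / 2) * k ^ (-a) * (v ^ 2 + k ^ 2) ^ (a / 2) *
        (k ^ (-4 : ℝ) * (1 + (t / k) ^ 2)⁻¹) := by gcongr
    _ = _ := by rw [sub_eq_add_neg (-a), Real.rpow_add hk0]; ring

/-- The bound `I_j(v) ≪ k^{−6−λ}(v² + k²)^{(3+λ)/2}` for the Gamma-quotient
integral appearing in the estimation of the off-diagonal terms in Section 5. -/
theorem gamma_quotient_integral_bound (lam l : ℝ) (hlam : 0 ≤ lam)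
    (hl : 15 + 5 * lam < l) :
    ∃ C : ℝ, 0 < C ∧ ∀ k : ℝ, 21 + 3 * lam < k → ∀ v : ℝ,
      (∫ t : ℝ,
          norm (Complex.Gamma ((((k - 7 - lam) / 2 : ℝ) : ℂ) - (t : ℂ) / 2 * Complex.I)) *
            norm (Complex.Gamma ((((3 + lam + l) / 2 : ℝ) : ℂ) +
              ((t : ℂ) / 2 - (v : ℂ)) * Complex.I)) /
          (norm (Complex.Gamma ((((k + 7 + lam) / 2 : ℝ) : ℂ) + (t : ℂ) / 2 * Complex.I)) *
            norm (Complex.Gamma ((((l - 3 - lam) / 2 : ℝ) : ℂ) +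
              ((v : ℂ) - (t : ℂ) / 2) * Complex.I)))) ≤
        C * k ^ (-6 - lam) * (v ^ 2 + k ^ 2) ^ ((3 + lam) / 2) := by
  obtain ⟨C₁, hC₁, h₁⟩ := exists_rpow_mul_norm_Gamma_le (δ := 7 + lam) (by linarith)
  obtain ⟨C₂, hC₂, h₂⟩ := exists_norm_Gamma_add_le (δ := 3 + lam) (by linarith)
  set y := (l - 3 - lam) / 2 with hy
  set D := C₁ * C₂ * (9 ^ ((3 + lam + 4) / 2) * (y ^ 2 + 2) ^ ((3 + lam) / 2)) with hD
  have hD0 : 0 < D := by positivity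
  refine ⟨D * Real.pi, by positivity, fun k hk v ↦ ?_⟩
  have hk0 : 0 < k := by linarith
  have hinteg : Integrable fun t : ℝ ↦ (1 + (t / k) ^ 2)⁻¹ :=
    integrable_inv_one_add_sq.comp_div hk0.ne'
  set E := D * k ^ (-(3 + lam) - 4) * (v ^ 2 + k ^ 2) ^ ((3 + lam) / 2) with hE
  calc _ ≤ ∫ t : ℝ, E * (1 + (t / k) ^ 2)⁻¹ := by
        refine integral_mono_of_nonneg (Filter.Eventually.of_forall fun t ↦ by positivity)
          (hinteg.const_mul E) (Filter.Eventually.of_forall fun t ↦ ?_)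
        set s₁ : ℂ := ((k - 7 - lam) / 2 : ℝ) + (t / 2 : ℝ) * I with hs₁
        set s₂ : ℂ := (y : ℂ) + (t / 2 - v : ℝ) * I with hs₂
        have hre₁ : s₁.re = (k - 7 - lam) / 2 := by simp [hs₁]
        have him₁ : s₁.im = t / 2 := by simp [hs₁]
        have hre₂ : s₂.re = y := by simp [hs₂]
        have him₂ : s₂.im = t / 2 - v := by simp [hs₂]
        have e₁ : ‖Gamma ((((k - 7 - lam) / 2 : ℝ) : ℂ) - (t : ℂ) / 2 * I)‖ = ‖Gamma s₁‖ := by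
          rw [hs₁, ← norm_Gamma_sub_mul_I]
          push_cast
          rfl
        have e₂ : (((3 + lam + l) / 2 : ℝ) : ℂ) + ((t : ℂ) / 2 - (v : ℂ)) * I =
            s₂ + (3 + lam : ℝ) := by
          rw [hs₂, hy]; push_cast; ring
        have e₃ : (((k + 7 + lam) / 2 : ℝ) : ℂ) + (t : ℂ) / 2 * I = s₁ + (7 + lam : ℝ) := by
          rw [hs₁]; push_cast; ring
        have e₄ : ‖Gamma ((y : ℂ) + ((v : ℂ) - (t : ℂ) / 2) * I)‖ = ‖Gamma s₂‖ := by
          rw [hs₂, ← norm_Gamma_sub_mul_I]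
          congr 2
          push_cast
          ring
        have hre_s₁ : 1 ≤ s₁.re := by linarith
        have hre_s₂ : 1 ≤ s₂.re := by linarith
        have hnorm_s₁ : 0 < ‖s₁‖ := by linarith [re_le_norm s₁]
        have hG₂ : 0 < ‖Gamma s₂‖ := norm_pos_iff.2 (Gamma_ne_zero_of_re_pos (by linarith))
        have hG₁ : 0 < ‖Gamma (s₁ + (7 + lam : ℝ))‖ :=
          norm_pos_iff.2 (Gamma_ne_zero_of_re_pos (by
            simp only [add_re, ofReal_re]; linarith))
        have hw := rpow_quotient_le (a := 3 + lam) (k := k) (v := v) (t := t) (y := y)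
          (N₁ := ‖s₁‖) (N₂ := ‖s₂‖) (by linarith) (by linarith)
          (by
            rw [Complex.sq_norm, normSq_apply, hre₁, him₁]
            have : k / 3 ≤ (k - 7 - lam) / 2 := by linarith
            nlinarith [sq_nonneg t])
          hnorm_s₁ (norm_nonneg _)
          (by rw [Complex.sq_norm, normSq_apply, hre₂, him₂]; ring)
        have hq₁ : ‖Gamma s₁‖ / ‖Gamma (s₁ + (7 + lam : ℝ))‖ ≤
            C₁ * (‖s₁‖ ^ (3 + lam + 4))⁻¹ := by
          rw [div_le_iff₀ hG₁, mul_right_comm, ← div_eq_mul_inv, le_div_iff₀ (by positivity),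
            mul_comm, show 3 + lam + 4 = 7 + lam by ring]
          exact h₁ s₁ hre_s₁
        have hq₂ : ‖Gamma (s₂ + (3 + lam : ℝ))‖ / ‖Gamma s₂‖ ≤ C₂ * ‖s₂‖ ^ (3 + lam) := by
          rw [div_le_iff₀ hG₂]
          exact h₂ s₂ hre_s₂
        beta_reduce
        rw [e₁, e₂, e₃, e₄, mul_div_mul_comm]
        calc _ ≤ (C₁ * (‖s₁‖ ^ (3 + lam + 4))⁻¹) * (C₂ * ‖s₂‖ ^ (3 + lam)) := by gcongr
          _ = C₁ * C₂ * ((‖s₁‖ ^ (3 + lam + 4))⁻¹ * ‖s₂‖ ^ (3 + lam)) := by ring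
          _ ≤ _ := mul_le_mul_of_nonneg_left hw (by positivity)
          _ = _ := by rw [hE, hD]; ring
    _ = E * (k * Real.pi) := by
        rw [integral_const_mul, Measure.integral_comp_div (fun u : ℝ ↦ (1 + u ^ 2)⁻¹) k,
          integral_univ_inv_one_add_sq, abs_of_pos hk0, smul_eq_mul]
    _ = _ := by
        rw [hE, show -6 - lam = -(3 + lam) - 4 + 1 by ring, Real.rpow_add_one hk0.ne']
        ring
end
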